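/- arXiv:math/0205209 — 5 statements merged into one kernel-verified Lean document; each statement's English description precedes it below -/
import Mathlib

section
/- Let p₁, p₂, p₃, p₄ be four points in three-dimensional Euclidean space such that the distance between every pair of distinct points among them is at most √8. Then there is no point q lying in the interior of the convex hull of {p₁, p₂, p₃, p₄} such that dist(q, pᵢ) ≥ 2 for every i ∈ {1,2,3,4}. -/
/-- A point of the convex hull of a set whose points are pairwise at distance at most `√2 * r`
is at distance less than `r` from some point of the set. -/
theorem exists_dist_lt_of_mem_convexHull {E : Type*} [NormedAddCommGroup E]
    [InnerProductSpace ℝ E] {s : Set E} {r : ℝ} (hr : 0 < r)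
    (hs : ∀ x ∈ s, ∀ y ∈ s, dist x y ^ 2 ≤ 2 * r ^ 2) {q : E} (hq : q ∈ convexHull ℝ s) :
    ∃ x ∈ s, dist q x < r := by
  by_contra! h
  have hinner : ∀ x ∈ s, ∀ y ∈ s, 0 ≤ inner ℝ (x - q) (y - q) := by
    intro x hx y hy
    have hxy := hs x hx y hy
    have hqx := pow_le_pow_left₀ hr.le (h x hx) 2
    have hqy := pow_le_pow_left₀ hr.le (h y hy) 2
    rw [dist_eq_norm, ← sub_sub_sub_cancel_right x y q, norm_sub_sq_real] at hxy
    rw [dist_comm, dist_eq_norm] at hqx hqy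
    linarith
  obtain ⟨ι, _, w, a, hw₀, hw₁, ha, hwa⟩ := mem_convexHull_iff_exists_fintype.1 hq
  obtain ⟨k, -, hk⟩ : ∃ k ∈ Finset.univ, 0 < w k :=
    Finset.exists_lt_of_sum_lt (f := fun _ ↦ 0) (by simp [hw₁])
  have hsum : ∑ i, w i * inner ℝ (a k - q) (a i - q) = 0 := by
    simp_rw [← real_inner_smul_right, ← inner_sum, smul_sub, Finset.sum_sub_distrib,
      ← Finset.sum_smul, hwa, hw₁, one_smul, sub_self, inner_zero_right]
  have hzero := (Finset.sum_eq_zero_iff_of_nonneg fun i _ ↦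
    mul_nonneg (hw₀ i) (hinner _ (ha k) _ (ha i))).1 hsum k (Finset.mem_univ k)
  have hqk : q = a k := by
    simpa [hk.ne', sub_eq_zero, eq_comm] using hzero
  exact (hr.trans_le (h _ (ha k))).ne' (by rw [← hqk, dist_self])

/-- Problem 1 instance (Example 2.6 of the paper): if four points in
three-dimensional Euclidean space have pairwise distances at most √8, then
there is no point in the interior of their convex hull whose distance to
every one of the four points is at least 2. -/
theorem no_interior_point_far_from_tetrahedron_vertices
    (p : Fin 4 → EuclideanSpace ℝ (Fin 3))
    (hedges : ∀ i j, i ≠ j → dist (p i) (p j) ≤ Real.sqrt 8) :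
    ¬ ∃ q ∈ interior (convexHull ℝ (Set.range p)), ∀ i, 2 ≤ dist q (p i) := by
  rintro ⟨q, hq, h⟩
  have hs : ∀ x ∈ Set.range p, ∀ y ∈ Set.range p, dist x y ^ 2 ≤ 2 * (2 : ℝ) ^ 2 := by
    rintro _ ⟨i, rfl⟩ _ ⟨j, rfl⟩
    obtain rfl | hij := eq_or_ne i j
    · simp
    · calc dist (p i) (p j) ^ 2 ≤ Real.sqrt 8 ^ 2 := by gcongr; exact hedges i j hij
        _ = 2 * 2 ^ 2 := by norm_num
  obtain ⟨_, ⟨i, rfl⟩, hi⟩ := exists_dist_lt_of_mem_convexHull two_pos hs (interior_subset hq)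
  exact hi.not_ge (h i)
end

section
/- Let p₁, p₂, p₃ be three points in three-dimensional Euclidean space such that the distance between every pair of distinct points among them is at most √8. Then there is no point q in the convex hull of {p₁, p₂, p₃} such that dist(q, pᵢ) ≥ 2 for every i ∈ {1,2,3}. -/
/-- The parallel axis theorem: the weighted second moment about `x` equals the one about the
barycenter `q` plus the squared distance from `x` to `q`. -/
lemma sum_mul_dist_sq_eq_of_barycenter {ι E : Type*} [Fintype ι] [NormedAddCommGroup E]
    [InnerProductSpace ℝ E] (p : ι → E) (w : ι → ℝ) (hw : ∑ i, w i = 1) {q : E}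
    (hq : ∑ i, w i • p i = q) (x : E) :
    ∑ i, w i * dist x (p i) ^ 2 = dist x q ^ 2 + ∑ i, w i * dist q (p i) ^ 2 := by
  have hzero : ∑ i, w i • (q - p i) = 0 := by
    simp_rw [smul_sub]
    rw [Finset.sum_sub_distrib, ← Finset.sum_smul, hw, hq, one_smul, sub_self]
  have hcross : ∑ i, w i * inner ℝ (x - q) (q - p i) = 0 := by
    simp_rw [← real_inner_smul_right]
    rw [← inner_sum, hzero, inner_zero_right]
  have hterm (i : ι) : w i * dist x (p i) ^ 2 = w i * dist x q ^ 2 +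
      2 * (w i * inner ℝ (x - q) (q - p i)) + w i * dist q (p i) ^ 2 := by
    rw [dist_eq_norm, dist_eq_norm, dist_eq_norm, ← sub_add_sub_cancel x q (p i),
      norm_add_sq_real]
    ring
  simp_rw [hterm]
  rw [Finset.sum_add_distrib, Finset.sum_add_distrib, ← Finset.sum_mul, ← Finset.mul_sum, hw,
    hcross]
  ring

/-- If finitely many points have pairwise squared distances at most `2 * r ^ 2`, the open balls of
radius `r > 0` around them cover their convex hull. -/
lemma exists_dist_lt_of_mem_convexHull_range {ι E : Type*} [Fintype ι] [NormedAddCommGroup E]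
    [InnerProductSpace ℝ E] {p : ι → E} {r : ℝ} (hr : 0 < r)
    (hp : ∀ i j, i ≠ j → dist (p i) (p j) ^ 2 ≤ 2 * r ^ 2) {q : E}
    (hq : q ∈ convexHull ℝ (Set.range p)) : ∃ i, dist q (p i) < r := by
  classical
  by_contra! hfar
  have hfar_sq (i : ι) : r ^ 2 ≤ dist q (p i) ^ 2 := pow_le_pow_left₀ hr.le (hfar i) 2
  obtain ⟨w, ⟨hw₀, hw₁⟩, hwq⟩ : ∃ w ∈ stdSimplex ℝ ι, ∑ i, w i • p i = q := by
    have hp_range : Set.range p =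
        Fintype.linearCombination ℝ p '' Set.range fun i : ι ↦ Pi.single i (1 : ℝ) := by
      rw [← Set.range_comp]
      simp [Function.comp_def]
    rwa [hp_range, ← LinearMap.image_convexHull, convexHull_rangle_single_eq_stdSimplex] at hq
  obtain ⟨j, -, hj⟩ : ∃ j ∈ Finset.univ, 0 < w j :=
    Finset.exists_lt_of_sum_lt (f := fun _ ↦ (0 : ℝ)) (by simp [hw₁])
  have hlower : r ^ 2 ≤ ∑ i, w i * dist q (p i) ^ 2 := by
    calc r ^ 2 = ∑ i, w i * r ^ 2 := by rw [← Finset.sum_mul, hw₁, one_mul]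
      _ ≤ _ := Finset.sum_le_sum fun i _ ↦ mul_le_mul_of_nonneg_left (hfar_sq i) (hw₀ i)
  have hupper : ∑ i, w i * dist (p j) (p i) ^ 2 < ∑ i, w i * (2 * r ^ 2) := by
    refine Finset.sum_lt_sum (fun i _ ↦ mul_le_mul_of_nonneg_left ?_ (hw₀ i))
      ⟨j, Finset.mem_univ j, ?_⟩
    · rcases eq_or_ne j i with rfl | hji
      · rw [dist_self, zero_pow two_ne_zero]
        positivity
      · exact hp j i hji
    · rw [dist_self, zero_pow two_ne_zero]
      exact mul_lt_mul_of_pos_left (by positivity) hj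
  rw [sum_mul_dist_sq_eq_of_barycenter p w hw₁ hwq, ← Finset.sum_mul, hw₁, dist_comm] at hupper
  linarith [hfar_sq j]

/-- The two-dimensional face verification used in Example 2.6: if three points
in three-dimensional Euclidean space have pairwise distances at most √8, then
no point of their convex hull has distance at least 2 from all three points. -/
theorem no_point_of_triangle_far_from_vertices
    (p : Fin 3 → EuclideanSpace ℝ (Fin 3))
    (hedges : ∀ i j, i ≠ j → dist (p i) (p j) ≤ Real.sqrt 8) :
    ¬ ∃ q ∈ convexHull ℝ (Set.range p), ∀ i, 2 ≤ dist q (p i) := by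
  rintro ⟨q, hq, hfar⟩
  obtain ⟨i, hi⟩ := exists_dist_lt_of_mem_convexHull_range (r := 2) two_pos
    (fun i j hij ↦ ((Real.le_sqrt dist_nonneg (by norm_num)).mp (hedges i j hij)).trans
      (by norm_num)) hq
  exact (hfar i).not_gt hi
end

section
/- Let p₁, p₂, p₃, p₄ be four points in three-dimensional Euclidean space with dist(pᵢ, pⱼ) = √8 for all i ≠ j (a regular tetrahedron of edge length √8). Then there is exactly one point q in the convex hull of {p₁, p₂, p₃, p₄} satisfying dist(q, p₁) = dist(q, p₂) = dist(q, p₃) = 2, and this point satisfies dist(q, p₄) < 2. -/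
open Finset in
/-- In an equilateral family of points with squared mutual distance `c`, the squared distance
between two affine combinations is `c / 2` times the squared distance of the weight vectors. -/
theorem dist_sq_affineCombination_of_equilateral {ι V P : Type*} [Fintype ι]
    [NormedAddCommGroup V] [InnerProductSpace ℝ V] [MetricSpace P] [NormedAddTorsor V P]
    {p : ι → P} {c : ℝ} (hp : ∀ i j, i ≠ j → dist (p i) (p j) ^ 2 = c)
    {v w : ι → ℝ} (hv : ∑ i, v i = 1) (hw : ∑ i, w i = 1) :
    dist (univ.affineCombination ℝ p v) (univ.affineCombination ℝ p w) ^ 2 =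
      c / 2 * ∑ i, (v i - w i) ^ 2 := by
  classical
  have hsum : ∑ i, (v i - w i) = 0 := by rw [sum_sub_distrib, hv, hw, sub_self]
  have hd (i j : ι) : dist (p i) (p j) * dist (p i) (p j) = c - if i = j then c else 0 := by
    split_ifs with h
    · simp [h]
    · rw [← pow_two, hp i j h, sub_zero]
  rw [pow_two, EuclideanGeometry.dist_affineCombination p hv hw]
  simp only [hd, Pi.sub_apply, mul_sub, sum_sub_distrib, mul_ite, mul_zero, sum_ite_eq, mem_univ,
    if_true, ← sum_mul, ← mul_sum] at hsum ⊢
  have hsq : ∑ i, (v i - w i) ^ 2 = ∑ i, (v i - w i) * v i - ∑ i, (v i - w i) * w i := by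
    rw [← sum_sub_distrib]
    exact sum_congr rfl fun i _ => by ring
  rw [hsum, hsq]
  ring

open Finset in
/-- The squared distance from an affine combination of an equilateral family of points to one of
these points. -/
theorem dist_sq_affineCombination_vertex_of_equilateral {ι V P : Type*} [Fintype ι] [DecidableEq ι]
    [NormedAddCommGroup V] [InnerProductSpace ℝ V] [MetricSpace P] [NormedAddTorsor V P]
    {p : ι → P} {c : ℝ} (hp : ∀ i j, i ≠ j → dist (p i) (p j) ^ 2 = c)
    {w : ι → ℝ} (hw : ∑ i, w i = 1) (k : ι) :
    dist (univ.affineCombination ℝ p w) (p k) ^ 2 =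
      c / 2 * ∑ i, (w i - (Pi.single k 1 : ι → ℝ) i) ^ 2 := by
  rw [← dist_sq_affineCombination_of_equilateral hp hw (by simp),
    univ.affineCombination_of_eq_one_of_eq_zero (Pi.single k 1) p (mem_univ k) (by simp)
      (fun j _ hj => by simp [hj])]

open Finset in
/-- The only convex weights whose combination of the vertices of a regular tetrahedron of edge
length `√8` is at distance `2` from the first three vertices are `1/6, 1/6, 1/6, 1/2`. -/
theorem dist_affineCombination_regular_tetrahedron_eq_two_iff {V P : Type*}
    [NormedAddCommGroup V] [InnerProductSpace ℝ V] [MetricSpace P] [NormedAddTorsor V P]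
    {p : Fin 4 → P} (hp : ∀ i j, i ≠ j → dist (p i) (p j) ^ 2 = 8)
    {w : Fin 4 → ℝ} (hw : ∑ i, w i = 1) (hw₀ : 0 ≤ w 3) :
    (dist (univ.affineCombination ℝ p w) (p 0) = 2 ∧
      dist (univ.affineCombination ℝ p w) (p 1) = 2 ∧
      dist (univ.affineCombination ℝ p w) (p 2) = 2) ↔ w = ![1/6, 1/6, 1/6, 1/2] := by
  have hdist (k : Fin 4) : dist (univ.affineCombination ℝ p w) (p k) = 2 ↔
      8 / 2 * ∑ i, (w i - (Pi.single k 1 : Fin 4 → ℝ) i) ^ 2 = 2 ^ 2 := by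
    rw [← dist_sq_affineCombination_vertex_of_equilateral hp hw,
      pow_left_inj₀ dist_nonneg zero_le_two two_ne_zero]
  simp only [hdist]
  simp only [Fin.sum_univ_four] at hw ⊢
  simp only [Pi.single_apply, Fin.reduceEq, if_true, if_false, sub_zero]
  constructor
  · rintro ⟨h0, h1, h2⟩
    have h01 : w 1 = w 0 := by linarith
    have h02 : w 2 = w 0 := by linarith
    have h3 : w 3 = 1 - 3 * w 0 := by linarith
    rw [h01, h02, h3] at h0
    have hprod : (6 * w 0 - 1) * (2 * w 0 - 1) = 0 := by linarith
    have hw0 : w 0 = 1 / 6 := by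
      rcases mul_eq_zero.mp hprod with h | h <;> linarith
    ext i
    fin_cases i <;> simp <;> linarith
  · rintro rfl
    simp only [Matrix.cons_val]
    norm_num

/-- Terminal configuration of Example 2.6: in a regular tetrahedron of edge
length √8, there is exactly one point of the convex hull at distance exactly 2
from the first three vertices, and this point is at distance less than 2 from
the fourth vertex. -/
theorem regular_sqrt8_tetrahedron_unique_point
    (p : Fin 4 → EuclideanSpace ℝ (Fin 3))
    (hedges : ∀ i j, i ≠ j → dist (p i) (p j) = Real.sqrt 8) :
    (∃! q : EuclideanSpace ℝ (Fin 3),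
        q ∈ convexHull ℝ (Set.range p) ∧
        dist q (p 0) = 2 ∧ dist q (p 1) = 2 ∧ dist q (p 2) = 2) ∧
    (∀ q : EuclideanSpace ℝ (Fin 3),
        q ∈ convexHull ℝ (Set.range p) →
        dist q (p 0) = 2 → dist q (p 1) = 2 → dist q (p 2) = 2 →
        dist q (p 3) < 2) := by
  have hp : ∀ i j, i ≠ j → dist (p i) (p j) ^ 2 = 8 := fun i j h => by
    rw [hedges i j h, Real.sq_sqrt (by norm_num)]
  set w : Fin 4 → ℝ := ![1/6, 1/6, 1/6, 1/2] with hw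
  have hw_sum : ∑ i, w i = 1 := by
    simp only [hw, Fin.sum_univ_four, Matrix.cons_val]
    norm_num
  have hw_nonneg : ∀ i ∈ Finset.univ, 0 ≤ w i := fun i _ => by fin_cases i <;> norm_num [hw]
  have huniq (q) (hq : q ∈ convexHull ℝ (Set.range p))
      (hd : dist q (p 0) = 2 ∧ dist q (p 1) = 2 ∧ dist q (p 2) = 2) :
      q = Finset.univ.affineCombination ℝ p w := by
    rw [convexHull_range_eq_exists_affineCombination] at hq
    obtain ⟨s, v, hv_nonneg, hv_sum, rfl⟩ := hq
    rw [← Finset.sum_indicator_subset v s.subset_univ] at hv_sum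
    rw [Finset.affineCombination_indicator_subset v p s.subset_univ] at hd ⊢
    rw [(dist_affineCombination_regular_tetrahedron_eq_two_iff hp hv_sum
      (Set.indicator_nonneg hv_nonneg 3)).1 hd]
  refine ⟨⟨Finset.univ.affineCombination ℝ p w, ⟨affineCombination_mem_convexHull hw_nonneg hw_sum,
    (dist_affineCombination_regular_tetrahedron_eq_two_iff hp hw_sum
      (hw_nonneg 3 (Finset.mem_univ 3))).2 hw⟩, fun q hq => huniq q hq.1 hq.2⟩, ?_⟩
  intro q hq h0 h1 h2
  rw [huniq q hq ⟨h0, h1, h2⟩]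
  refine lt_of_pow_lt_pow_left₀ 2 zero_le_two ?_
  rw [dist_sq_affineCombination_vertex_of_equilateral hp hw_sum]
  simp only [hw, Fin.sum_univ_four, Pi.single_apply, Matrix.cons_val, Fin.reduceEq, if_true,
    if_false]
  norm_num
end

section
/- Let m and n be finite index types, let A be an m × n real matrix, b : m → ℝ, c : n → ℝ, and let K, M be real numbers. Suppose M is the maximum of the original primal problem, i.e., M is the greatest value of c · x over all x : n → ℝ satisfying (A x)ⱼ ≤ bⱼ for all j, and suppose M > K. Then: (1) M is also the greatest value of c · x + K·t over all pairs (x, t) with 0 ≤ t ≤ 1 and (A x)ⱼ + t·bⱼ ≤ bⱼ for all j (the modified primal problem); and (2) every pair (x₀, t₀) attaining this maximum of the modified primal problem has t₀ = 0. -/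
open Matrix

/-- Adding `t` times an optimal solution of the primal problem to a point `x` that is feasible for
the right-hand side `(1 - t) • b` gives a primal feasible point, which bounds `c ⬝ᵥ x`. -/
theorem dotProduct_add_mul_le_of_isGreatest
    {m n : Type*} [Fintype n] {A : Matrix m n ℝ} {b : m → ℝ} {c : n → ℝ} {M : ℝ}
    (hM : IsGreatest {v : ℝ | ∃ x : n → ℝ, (∀ j, A.mulVec x j ≤ b j) ∧ v = c ⬝ᵥ x} M)
    {x : n → ℝ} {t : ℝ} (ht : 0 ≤ t) (hx : ∀ j, A.mulVec x j + t * b j ≤ b j) :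
    c ⬝ᵥ x + t * M ≤ M := by
  obtain ⟨⟨y, hy, rfl⟩, hub⟩ := hM
  refine hub ⟨x + t • y, fun j => ?_, by simp [dotProduct_add, dotProduct_smul]⟩
  have h := mul_le_mul_of_nonneg_left (hy j) ht
  simp only [mulVec_add, mulVec_smul, Pi.add_apply, Pi.smul_apply, smul_eq_mul]
  linarith [hx j]

/-- If M > K is the maximum of the primal problem max c·x subject to A x ≤ b,
then M is also the maximum of the modified primal max c·x + K t subject to
A x + t • b ≤ b, 0 ≤ t ≤ 1, and every optimal solution of the modified primal
has t = 0. -/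
theorem modified_primal_optimum
    {m n : Type*} [Fintype m] [Fintype n]
    (A : Matrix m n ℝ) (b : m → ℝ) (c : n → ℝ) (K M : ℝ)
    (hM : IsGreatest {v : ℝ | ∃ x : n → ℝ, (∀ j, A.mulVec x j ≤ b j) ∧
            v = c ⬝ᵥ x} M)
    (hK : K < M) :
    IsGreatest {v : ℝ | ∃ (x : n → ℝ) (t : ℝ), 0 ≤ t ∧ t ≤ 1 ∧
        (∀ j, A.mulVec x j + t * b j ≤ b j) ∧ v = c ⬝ᵥ x + K * t} M ∧
    (∀ (x₀ : n → ℝ) (t₀ : ℝ), 0 ≤ t₀ → t₀ ≤ 1 →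
        (∀ j, A.mulVec x₀ j + t₀ * b j ≤ b j) →
        c ⬝ᵥ x₀ + K * t₀ = M → t₀ = 0) := by
  refine ⟨⟨?_, ?_⟩, fun x t ht _ hx hopt => ?_⟩
  · obtain ⟨y, hy, hv⟩ := hM.1
    exact ⟨y, 0, le_rfl, zero_le_one, by simpa using hy, by simpa using hv⟩
  · rintro _ ⟨x, t, ht, -, hx, rfl⟩
    nlinarith [dotProduct_add_mul_le_of_isGreatest hM ht hx]
  · nlinarith [dotProduct_add_mul_le_of_isGreatest hM ht hx]
end

section
/- Let n, m, m' be finite index types, let A' be an m' × n real matrix, A an m × n real matrix, b' : m' → ℝ, b : m → ℝ, c : n → ℝ, y₀ : m' → ℝ, and z₀ : m → ℝ with z₀ⱼ ≥ 0 for all j. Define the error vector δ : n → ℝ by δ = c − y₀ A' − z₀ A (where y₀ A' denotes the row vector with entries ∑ⱼ (y₀)ⱼ A' j i, and similarly for z₀ A). Let D be a real number and let x : n → ℝ be any feasible solution of the primal, i.e., A' x = b' (componentwise), A x ≤ b (componentwise), and suppose δ · x ≤ D. Then c · x ≤ D + y₀ · b' + z₀ · b. -/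
open Matrix

/-- Rigorous verification of a numerically obtained dual solution: if
δ = c − y₀ A' − z₀ A is the error vector, z₀ ≥ 0, x is primal feasible
(A' x = b', A x ≤ b), and δ · x ≤ D, then c · x ≤ D + y₀ · b' + z₀ · b. -/
theorem rigorous_lp_bound
    {n m m' : Type*} [Fintype n] [Fintype m] [Fintype m']
    (A' : Matrix m' n ℝ) (A : Matrix m n ℝ)
    (b' : m' → ℝ) (b : m → ℝ) (c : n → ℝ)
    (y₀ : m' → ℝ) (z₀ : m → ℝ) (hz₀ : ∀ j, 0 ≤ z₀ j)
    (δ : n → ℝ) (hδ : δ = c - A'.vecMul y₀ - A.vecMul z₀)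
    (D : ℝ) (x : n → ℝ)
    (heq : ∀ j, A'.mulVec x j = b' j)
    (hineq : ∀ j, A.mulVec x j ≤ b j)
    (hD : δ ⬝ᵥ x ≤ D) :
    c ⬝ᵥ x ≤ D + y₀ ⬝ᵥ b' + z₀ ⬝ᵥ b := by
  have hy : y₀ ⬝ᵥ A'.mulVec x = y₀ ⬝ᵥ b' := congrArg (y₀ ⬝ᵥ ·) (funext heq)
  have hz : z₀ ⬝ᵥ A.mulVec x ≤ z₀ ⬝ᵥ b :=
    Finset.sum_le_sum fun j _ => mul_le_mul_of_nonneg_left (hineq j) (hz₀ j)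
  rw [hδ, sub_dotProduct, sub_dotProduct, ← dotProduct_mulVec, ← dotProduct_mulVec] at hD
  linarith
end
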